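/- Let K/k be a purely inseparable extension of characteristic p > 0, and suppose the degree of irrationality di(K/k) = sup_n di((k^{p^{-n}} ∩ K)/k) is finite (K/k is q-finite). Then the relative perfect closure rp(K/k) satisfies: K/rp(K/k) is a finite extension, and the sequence k(K^{p^n}) stabilizes at rp(K/k) from some index onward. -/

import Mathlib

/-!
Common definitions: purely inseparable extension theory (r-bases, degree of
irrationality, relative perfect closure, modularity), following Fliouet,
"Extensions absolument lq-finies".
-/

open IntermediateField

noncomputable section

/-- `k(K^p)`: the intermediate field of `K/k` generated by the `p`-th powers of `K`. -/
def pClosure (k K : Type*) [Field k] [Field K] [Algebra k K] (p : ℕ) : IntermediateField k K :=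
  adjoin k {x : K | ∃ y : K, y ^ p = x}

/-- `k(K^{p^n})`. -/
def pnClosure (k K : Type*) [Field k] [Field K] [Algebra k K] (p n : ℕ) : IntermediateField k K :=
  adjoin k {x : K | ∃ y : K, y ^ p ^ n = x}

/-- `k(L^p)` for an intermediate field `L` of `Ω/k`. -/
def pClosureOf {k Ω : Type*} [Field k] [Field Ω] [Algebra k Ω] (p : ℕ)
    (L : IntermediateField k Ω) : IntermediateField k Ω :=
  adjoin k {x : Ω | ∃ y ∈ L, y ^ p = x}

/-- `B` is `r`-free over the intermediate field `L` (typically `L = k(K^p)`):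
no `x ∈ B` belongs to `L(B \ {x})`. -/
def RFreeOver {k K : Type*} [Field k] [Field K] [Algebra k K]
    (L : IntermediateField k K) (B : Set K) : Prop :=
  ∀ x ∈ B, x ∉ adjoin L (B \ {x})

/-- `B` is an `r`-basis of `K/k` : `K = k(K^p)(B)` and `B` is `r`-free over `k(K^p)`. -/
def RBasis (k K : Type*) [Field k] [Field K] [Algebra k K] (p : ℕ) (B : Set K) : Prop :=
  adjoin (pClosure k K p) B = ⊤ ∧ RFreeOver (pClosure k K p) B

/-- `B` is an `r`-basis of `L/F` where `F ≤ L` are intermediate fields of `Ω/k`: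
`L = F(L^p)(B)` and no `x ∈ B` lies in `F(L^p)(B \ {x})`. -/
def RBasisRel {k Ω : Type*} [Field k] [Field Ω] [Algebra k Ω] (p : ℕ)
    (F L : IntermediateField k Ω) (B : Set Ω) : Prop :=
  B ⊆ (L : Set Ω) ∧ F ⊔ pClosureOf p L ⊔ adjoin k B = L ∧
    ∀ x ∈ B, x ∉ F ⊔ pClosureOf p L ⊔ adjoin k (B \ {x})

/-- The degree of irrationality of a bounded-exponent extension:
the cardinality of an `r`-basis of `K/k`. -/
def diCard (k K : Type*) [Field k] [Field K] [Algebra k K] (p : ℕ) : Cardinal :=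
  sInf {c : Cardinal | ∃ B : Set K, RBasis k K p B ∧ Cardinal.mk B = c}

/-- `k^{p^{-n}} ∩ K = {x ∈ K | x^{p^n} ∈ k}`. -/
def expleq (k K : Type*) [Field k] [Field K] [Algebra k K] (p n : ℕ) : IntermediateField k K :=
  adjoin k {x : K | x ^ p ^ n ∈ (algebraMap k K).range}

/-- The degree of irrationality `di(K/k) = sup_n di(k^{p^{-n}} ∩ K / k)`. -/
def di (k K : Type*) [Field k] [Field K] [Algebra k K] (p : ℕ) : Cardinal :=
  ⨆ n : ℕ, diCard k (expleq k K p n) p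

/-- The relative perfect closure `rp(K/k)`: the largest intermediate field `L`
with `k(L^p) = L`. -/
def rp (k K : Type*) [Field k] [Field K] [Algebra k K] (p : ℕ) : IntermediateField k K :=
  sSup {L : IntermediateField k K | pClosureOf p L = L}

/-- `K/k` has unbounded exponent. -/
def UnboundedExp (k K : Type*) [Field k] [Field K] [Algebra k K] (p : ℕ) : Prop :=
  ∀ e : ℕ, ∃ x : K, x ^ p ^ e ∉ (algebraMap k K).range

/-- `K^{p^n}` as a subfield of `K`. -/
def pnPowers (K : Type*) [Field K] (p n : ℕ) : Subfield K :=
  Subfield.closure {x : K | ∃ y : K, y ^ p ^ n = x}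

/-- `K/k` is modular: for each `n`, `K^{p^n}` and `k` are linearly disjoint over
`K^{p^n} ∩ k`, i.e. every finite family of elements of `K^{p^n}` that is linearly
independent over `K^{p^n} ∩ k` remains linearly independent over `k`. -/
def Modular (k K : Type*) [Field k] [Field K] [Algebra k K] (p : ℕ) : Prop :=
  ∀ n : ℕ, ∀ s : Finset K, (↑s : Set K) ⊆ (pnPowers K p n : Set K) →
    LinearIndependent ↥(pnPowers K p n ⊓ (algebraMap k K).fieldRange)
      (fun x : s => (x : K)) →
    LinearIndependent ↥((algebraMap k K).fieldRange) (fun x : s => (x : K))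

/-- The exponent `o(a, F)` of `a` over an intermediate field `F`:
the least `m` with `a^{p^m} ∈ F`. -/
def expOf {k K : Type*} [Field k] [Field K] [Algebra k K] (p : ℕ)
    (F : IntermediateField k K) (a : K) : ℕ :=
  sInf {m : ℕ | a ^ p ^ m ∈ F}

/-- An intermediate field `L` of `K/k` is equiexponential of exponent `e` over `k`:
there is an `r`-basis `G` of `L/k` with `o(a, k(G \ {a})) = o(a, k) = e` for all `a ∈ G`. -/
def EquiExpOf {k K : Type*} [Field k] [Field K] [Algebra k K] (p : ℕ)
    (e : ℕ) (L : IntermediateField k K) : Prop :=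
  ∃ G : Set K, RBasisRel p ⊥ L G ∧
    ∀ a ∈ G, expOf p (adjoin k (G \ {a})) a = e ∧ expOf p (⊥ : IntermediateField k K) a = e

end

namespace QF

open Cardinal

variable {K : Type*} [Field K]

theorem relrank_sup_le (κ A B : Subfield K) (h : A ≤ B)
    (halg : ∀ x ∈ B, ∃ n : ℕ, 0 < n ∧ x ^ n ∈ A) :
    Subfield.relrank (κ ⊔ A) (κ ⊔ B) ≤ Subfield.relrank A B := by
  have hAE : A ≤ κ ⊔ A := le_sup_right
  have hE : κ ⊔ A ≤ κ ⊔ B := sup_le_sup_left h κ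
  let _ : Algebra A ↥(κ ⊔ A) := (Subfield.inclusion hAE).toAlgebra
  have : IsScalarTower A ↥(κ ⊔ A) K := IsScalarTower.of_algebraMap_eq' rfl
  rw [Subfield.relrank_eq_rank_of_le h, Subfield.relrank_eq_rank_of_le hE]
  have halg' : Algebra.IsAlgebraic A (Subfield.extendScalars h) := by
    constructor
    rintro ⟨x, hx⟩
    obtain ⟨n, hn, hxn⟩ := halg x hx
    have : IsIntegral A (⟨x, hx⟩ : Subfield.extendScalars h) := by
      refine IsIntegral.of_pow hn ?_
      have : (⟨x, hx⟩ : Subfield.extendScalars h) ^ n = algebraMap A _ ⟨x ^ n, hxn⟩ := by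
        ext; rfl
      rw [this]
      exact isIntegral_algebraMap
    exact this.isAlgebraic
  have key := IntermediateField.adjoin_rank_le_of_isAlgebraic_right (↥(κ ⊔ A))
    (Subfield.extendScalars h)
  have heq : IntermediateField.adjoin ↥(κ ⊔ A) ((Subfield.extendScalars h : IntermediateField A K) : Set K)
      = Subfield.extendScalars hE := by
    apply le_antisymm
    · rw [IntermediateField.adjoin_le_iff]
      intro x hx
      exact (le_sup_right : B ≤ κ ⊔ B) hx
    · intro x hx
      have hx' : x ∈ κ ⊔ B := hx
      have : κ ⊔ B ≤ (IntermediateField.adjoin ↥(κ ⊔ A) ((Subfield.extendScalars h : IntermediateField A K) : Set K)).toSubfield := by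
        refine sup_le ?_ ?_
        · intro y hy
          exact IntermediateField.algebraMap_mem _ (⟨y, (le_sup_left : κ ≤ κ ⊔ A) hy⟩ : ↥(κ ⊔ A))
        · intro y hy
          exact IntermediateField.subset_adjoin _ _ hy
      exact this hx'
  rw [heq] at key
  exact key

variable (p : ℕ) [ExpChar K p] (κ : Subfield K)

/-- `κ(N^{p^j})` as a subfield. -/
def P (j : ℕ) (N : Subfield K) : Subfield K := κ ⊔ N.map (iterateFrobenius K p j)

variable {p κ}

theorem le_P (j : ℕ) (N : Subfield K) : κ ≤ P p κ j N := le_sup_left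

theorem pow_mem_P (j : ℕ) (N : Subfield K) {x : K} (hx : x ∈ N) : x ^ p ^ j ∈ P p κ j N :=
  (le_sup_right : _ ≤ P p κ j N) ⟨x, hx, iterateFrobenius_def p j x⟩

theorem P_le_iff {j : ℕ} {N M : Subfield K} :
    P p κ j N ≤ M ↔ κ ≤ M ∧ ∀ x ∈ N, x ^ p ^ j ∈ M := by
  rw [P, sup_le_iff, Subfield.map_le_iff_le_comap]
  rfl

theorem P_mono {j : ℕ} {N M : Subfield K} (h : N ≤ M) : P p κ j N ≤ P p κ j M :=
  P_le_iff.2 ⟨le_P _ _, fun _ hx => pow_mem_P j M (h hx)⟩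

theorem P_le {j : ℕ} {N : Subfield K} (h : κ ≤ N) : P p κ j N ≤ N :=
  P_le_iff.2 ⟨h, fun _ hx => pow_mem hx _⟩

theorem P_zero {N : Subfield K} (h : κ ≤ N) : P p κ 0 N = N :=
  le_antisymm (P_le h) fun x hx => by simpa using pow_mem_P (κ := κ) (p := p) 0 N hx

theorem P_comp (i j : ℕ) (N : Subfield K) : P p κ i (P p κ j N) = P p κ (j + i) N := by
  apply le_antisymm
  · refine P_le_iff.2 ⟨le_P _ _, ?_⟩
    have : P p κ j N ≤ (P p κ (j + i) N).comap (iterateFrobenius K p i) := by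
      refine P_le_iff.2 ⟨?_, ?_⟩
      · intro x hx
        exact pow_mem (le_P _ _ hx) _
      · intro x hx
        rw [Subfield.mem_comap]
        rw [iterateFrobenius_def, ← pow_mul, ← pow_add]
        exact pow_mem_P _ _ hx
    intro x hx
    exact this hx
  · refine P_le_iff.2 ⟨le_P _ _, ?_⟩
    intro x hx
    rw [pow_add, pow_mul]
    exact pow_mem_P _ _ (pow_mem_P _ _ hx)

theorem P_rank_le (hp : 0 < p) (j : ℕ) {F N : Subfield K} (hκ : κ ≤ F) (h : F ≤ N)
    (hpi : ∀ x ∈ N, ∃ n : ℕ, x ^ p ^ n ∈ κ) :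
    Subfield.relrank (P p κ j F) (P p κ j N) ≤ Subfield.relrank F N := by
  refine (relrank_sup_le κ _ _ ((Subfield.gc_map_comap _).monotone_l h) ?_).trans
    (Subfield.relrank_map_map F N (iterateFrobenius K p j)).le
  rintro _ ⟨x, hx, rfl⟩
  obtain ⟨n, hn⟩ := hpi x hx
  exact ⟨p ^ n, pow_pos hp _, x ^ p ^ n, hκ hn, by simp⟩

theorem chain (hp : 0 < p) {N : Subfield K} (hκ : κ ≤ N)
    (hpi : ∀ x ∈ N, ∃ n : ℕ, x ^ p ^ n ∈ κ) {C : Cardinal}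
    (hC : Subfield.relrank (P p κ 1 N) N ≤ C) (j : ℕ) :
    Subfield.relrank (P p κ j N) N ≤ C ^ j := by
  induction j with
  | zero => rw [P_zero hκ]; simp
  | succ j ih =>
    have h1 : P p κ (j + 1) N ≤ P p κ j N := by
      rw [← P_comp]; exact P_le (le_P _ _)
    rw [← Subfield.relrank_mul_relrank h1 (P_le hκ), pow_succ']
    refine mul_le_mul' ?_ ih
    rw [add_comm, ← P_comp]
    exact (P_rank_le hp j (le_P _ _) (P_le hκ) hpi).trans hC

theorem relrank_lt_of_le {A B C : Subfield K} (h1 : A ≤ B) (h2 : B ≤ C)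
    (h : Subfield.relrank A C < ℵ₀) :
    Subfield.relrank A B < ℵ₀ ∧ Subfield.relrank B C < ℵ₀ ∧
      0 < Subfield.relfinrank A B ∧ 0 < Subfield.relfinrank B C := by
  have hpos : ∀ {A B : Subfield K}, Subfield.relrank A B ≠ 0 := by
    intro A B
    exact rank_pos.ne'
  rw [← Subfield.relrank_mul_relrank h1 h2] at h
  rcases Cardinal.mul_lt_aleph0_iff.1 h with h | h | h
  · exact (hpos h).elim
  · exact (hpos h).elim
  refine ⟨h.1, h.2, ?_, ?_⟩
  · rw [Subfield.relfinrank_eq_toNat_relrank]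
    exact Nat.pos_of_ne_zero (by rw [Ne, Cardinal.toNat_eq_zero]; push Not; exact ⟨hpos, h.1⟩)
  · rw [Subfield.relfinrank_eq_toNat_relrank]
    exact Nat.pos_of_ne_zero (by rw [Ne, Cardinal.toNat_eq_zero]; push Not; exact ⟨hpos, h.2⟩)

theorem D_mono (hp : 0 < p) {N M : Subfield K} (hκ : κ ≤ N) (h : N ≤ M)
    (hpi : ∀ x ∈ M, ∃ n : ℕ, x ^ p ^ n ∈ κ) (hfin : Subfield.relrank κ M < ℵ₀) :
    Subfield.relfinrank (P p κ 1 N) N ≤ Subfield.relfinrank (P p κ 1 M) M := by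
  have hPN : P p κ 1 N ≤ N := P_le hκ
  have hPM : P p κ 1 M ≤ M := P_le (hκ.trans h)
  have e1 := Subfield.relfinrank_mul_relfinrank hPN h
  have e2 := Subfield.relfinrank_mul_relfinrank (P_mono (p := p) (κ := κ) (j := 1) h) hPM
  have f0 := (relrank_lt_of_le hκ h hfin)
  have le : Subfield.relfinrank (P p κ 1 N) (P p κ 1 M) ≤ Subfield.relfinrank N M :=
    Cardinal.toNat_le_toNat (P_rank_le hp 1 hκ h hpi) f0.2.1
  have pos := f0.2.2.2
  rw [← e1] at e2
  by_contra! hlt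
  have : Subfield.relfinrank (P p κ 1 N) (P p κ 1 M) * Subfield.relfinrank (P p κ 1 M) M
      < Subfield.relfinrank (P p κ 1 N) N * Subfield.relfinrank N M := by
    rw [mul_comm]
    exact Nat.mul_lt_mul_of_lt_of_le hlt le pos
  omega

theorem D_strict (hp : 0 < p) {N : Subfield K} (hκ : κ ≤ N)
    (hpi : ∀ x ∈ N, ∃ n : ℕ, x ^ p ^ n ∈ κ) (hfin : Subfield.relrank κ N < ℵ₀)
    {x : K} (hx : x ∈ N) (hx1 : x ∉ P p κ 1 N) {j : ℕ} (hj : x ^ p ^ j ∈ κ) :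
    Subfield.relfinrank (P p κ (j + 1) N) (P p κ j N) < Subfield.relfinrank (P p κ 1 N) N := by
  set F : Subfield K := P p κ 1 N ⊔ Subfield.closure {x} with hF
  have hxF : x ∈ F := (le_sup_right : _ ≤ F) (Subfield.subset_closure rfl)
  have hPF : P p κ 1 N ≤ F := le_sup_left
  have hκF : κ ≤ F := (le_P _ _).trans hPF
  have hFN : F ≤ N := sup_le (P_le hκ) (Subfield.closure_le.2 (by simpa using hx))
  have hPjF : P p κ j F = P p κ (j + 1) N := by
    apply le_antisymm
    · refine P_le_iff.2 ⟨le_P _ _, ?_⟩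
      have : F ≤ (P p κ (j + 1) N).comap (iterateFrobenius K p j) := by
        refine sup_le ?_ ?_
        · intro y hy
          rw [Subfield.mem_comap, iterateFrobenius_def, add_comm, ← P_comp]
          exact pow_mem_P _ _ hy
        · rw [Subfield.closure_le]
          rintro y rfl
          rw [SetLike.mem_coe, Subfield.mem_comap, iterateFrobenius_def]
          exact le_P _ _ hj
      intro y hy
      exact this hy
    · rw [add_comm, ← P_comp]
      exact P_mono hPF
  have fF := relrank_lt_of_le hκF hFN hfin
  have le : Subfield.relfinrank (P p κ (j + 1) N) (P p κ j N) ≤ Subfield.relfinrank F N := by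
    rw [← hPjF]
    exact Cardinal.toNat_le_toNat (P_rank_le hp j hκF hFN hpi) fF.2.1
  have f1 := relrank_lt_of_le (le_P 1 N) hPF fF.1
  have ne1 : Subfield.relfinrank (P p κ 1 N) F ≠ 1 := by
    rw [Ne, Subfield.relfinrank_eq_one_iff]
    exact fun h => hx1 (h hxF)
  rw [← Subfield.relfinrank_mul_relfinrank hPF hFN]
  have p1 := f1.2.2.2
  have p2 := fF.2.2.2
  refine lt_of_le_of_lt le ?_
  exact lt_mul_of_one_lt_left p2 (by omega)

theorem core (hp : 0 < p) (L : ℕ → Subfield K) (hmono : Monotone L) (hκ : ∀ n, κ ≤ L n)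
    (hL : ∀ n, ∀ x ∈ L n, x ^ p ^ n ∈ κ) (hU : ∀ x, ∃ n, x ∈ L n) (C : ℕ)
    (hC : ∀ n, Subfield.relrank (P p κ 1 (L n)) (L n) ≤ C) :
    ∃ e, P p κ 1 (P p κ e ⊤) = P p κ e ⊤ ∧ Module.rank (P p κ e ⊤) K < ℵ₀ := by
  have hpi : ∀ n, ∀ x ∈ L n, ∃ m : ℕ, x ^ p ^ m ∈ κ := fun n x hx => ⟨n, hL n x hx⟩
  have hfin : ∀ n, Subfield.relrank κ (L n) < ℵ₀ := by
    intro n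
    have h1 : P p κ n (L n) = κ := le_antisymm (P_le_iff.2 ⟨le_rfl, hL n⟩) (le_P _ _)
    have := chain hp (hκ n) (hpi n) (hC n) n
    rw [h1] at this
    refine this.trans_lt ?_
    exact_mod_cast Cardinal.natCast_lt_aleph0 (n := C ^ n)
  have hPL : ∀ m n, P p κ m (L n) ≤ L n := fun m n => P_le (hκ n)
  let g : ℕ → ℕ → ℕ := fun m n => Subfield.relfinrank (P p κ (m + 1) (L n)) (P p κ m (L n))
  have gC : ∀ m n, g m n ≤ C := by
    intro m n
    have h := (P_rank_le (p := p) hp m (le_P 1 (L n)) (P_le (hκ n)) (hpi n)).trans (hC n)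
    rw [P_comp, add_comm] at h
    have := Cardinal.toNat_le_toNat h Cardinal.natCast_lt_aleph0
    simpa [g, Subfield.relfinrank_eq_toNat_relrank] using this
  have gmono : ∀ m, Monotone (g m) := by
    intro m a b hab
    have := D_mono (p := p) (κ := κ) hp (le_P m (L a)) (P_mono (j := m) (hmono hab))
      (fun x hx => hpi b x (hPL m b hx)) (relrank_lt_of_le (le_P m (L b)) (hPL m b) (hfin b)).1
    rw [P_comp, P_comp] at this
    exact this
  let f : ℕ → ℕ := fun m => sSup (Set.range (g m))
  have bdd : ∀ m, BddAbove (Set.range (g m)) := fun m => ⟨C, by rintro _ ⟨n, rfl⟩; exact gC m n⟩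
  obtain ⟨e, he⟩ : ∃ e, ∀ m, f e ≤ f m := by
    exact ⟨Function.argmin f, fun m => Function.argmin_le f m⟩
  have hdir : ∀ j, ∀ x ∈ P p κ j ⊤, ∃ n, ∀ m ≥ n, x ∈ P p κ j (L m) := by
    intro j x hx
    have hd : Directed (· ≤ ·) (fun n => P p κ j (L n)) :=
      Monotone.directed_le (fun a b hab => P_mono (hmono hab))
    have : P p κ j ⊤ ≤ ⨆ n, P p κ j (L n) := by
      refine P_le_iff.2 ⟨(le_P j (L 0)).trans (le_iSup (fun n => P p κ j (L n)) 0), ?_⟩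
      intro y _
      obtain ⟨n, hn⟩ := hU y
      exact (le_iSup (fun n => P p κ j (L n)) n) (pow_mem_P _ _ hn)
    obtain ⟨n, hn⟩ := (Subfield.mem_iSup_of_directed hd).1 (this hx)
    exact ⟨n, fun m hm => P_mono (hmono hm) hn⟩
  refine ⟨e, ?_, ?_⟩
  · refine le_antisymm (P_le (le_P _ _)) ?_
    intro x hx
    by_contra hx1
    obtain ⟨n1, hn1⟩ := hdir e x hx
    obtain ⟨j, hj⟩ := hU x
    have hj := hL j x hj
    obtain ⟨n2, hn2⟩ : ∃ n, g (e + j) n = f (e + j) := Nat.sSup_mem (Set.range_nonempty _) (bdd _)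
    set n := max n1 n2
    have hstrict := D_strict (p := p) (κ := κ) hp (le_P e (L n))
      (fun x hx => hpi n x (hPL e n hx)) (relrank_lt_of_le (le_P e (L n)) (hPL e n) (hfin n)).1
      (hn1 n (le_max_left _ _)) (fun h => hx1 (P_mono (P_mono le_top) h)) hj
    rw [P_comp, P_comp, P_comp] at hstrict
    have h1 : g (e + j) n < g e n := hstrict
    have h2 : g e n ≤ f e := le_csSup (bdd e) ⟨n, rfl⟩
    have h3 := he (e + j)
    have h4 : g (e + j) n2 ≤ g (e + j) n := gmono _ (le_max_right _ _)
    omega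
  · have hle : Module.rank (P p κ e ⊤) K ≤ (C ^ e : ℕ) := by
      apply rank_le
      intro s hs
      obtain ⟨n, hn⟩ : ∃ n, ∀ x ∈ s, x ∈ L n := by
        choose N hN using hU
        exact ⟨s.sup N, fun x hx => hmono (Finset.le_sup hx) (hN x)⟩
      have hc := chain hp (hκ n) (hpi n) (hC n) e
      rw [Subfield.relrank_eq_rank_of_le (hPL e n)] at hc
      let _ : Algebra (P p κ e (L n)) (P p κ e ⊤) :=
        (Subfield.inclusion (P_mono (p := p) (κ := κ) (j := e) (le_top : L n ≤ ⊤))).toAlgebra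
      have : IsScalarTower (P p κ e (L n)) (P p κ e ⊤) K := IsScalarTower.of_algebraMap_eq' rfl
      have hs' : LinearIndependent (P p κ e (L n)) (fun i : s => (i : K)) :=
        hs.restrict_scalars' _
      have hs'' : LinearIndependent (P p κ e (L n))
          (fun i : s => (⟨i, hn i i.2⟩ : Subfield.extendScalars (hPL e n))) :=
        LinearIndependent.of_comp (Subfield.extendScalars (hPL e n)).val.toLinearMap hs'
      have := hs''.cardinal_le_rank.trans hc
      simp only [Cardinal.mk_coe_finset] at this
      exact_mod_cast this
    exact hle.trans_lt Cardinal.natCast_lt_aleph0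

end QF

namespace QF

open Cardinal

section rb

variable {E K : Type*} [Field E] [Field K] [Algebra E K] {p : ℕ}

theorem rank_adjoin_simple_le (hp : 0 < p) {x : K} (hx : x ^ p ∈ (algebraMap E K).range) :
    FiniteDimensional E (adjoin E {x}) ∧ Module.finrank E (adjoin E {x}) ≤ p := by
  obtain ⟨a, ha⟩ := hx
  have hint : IsIntegral E x := IsIntegral.of_pow hp (by rw [← ha]; exact isIntegral_algebraMap)
  refine ⟨adjoin.finiteDimensional hint, ?_⟩
  rw [adjoin.finrank hint]
  have hm : (Polynomial.X ^ p - Polynomial.C a).Monic := Polynomial.monic_X_pow_sub_C a hp.ne'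
  have hdeg := Polynomial.natDegree_le_natDegree (minpoly.min E x hm (by simp [ha]))
  rwa [Polynomial.natDegree_X_pow_sub_C] at hdeg

theorem rank_tower_le (M : IntermediateField E K) (N : IntermediateField M K) :
    Module.rank E (N.restrictScalars E) = Module.rank E M * Module.rank M N := 
  (rank_mul_rank E M N).symm

theorem exchange [ExpChar E p] (hp : p.Prime) [IsPurelyInseparable E K] {x b : K}
    (hx : x ^ p ∈ (algebraMap E K).range) (hb : b ∈ adjoin E {x})
    (hb' : b ∉ (algebraMap E K).range) : x ∈ adjoin E {b} := by
  obtain ⟨hfd, hle⟩ := rank_adjoin_simple_le hp.pos hx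
  have hbx : adjoin E {b} ≤ adjoin E {x} := by
    rw [adjoin_le_iff]; simpa using hb
  have hfb : FiniteDimensional E (adjoin E {b}) :=
    adjoin.finiteDimensional (Algebra.IsIntegral.isIntegral b)
  obtain ⟨n, hn⟩ := IsPurelyInseparable.finrank_eq_pow E (adjoin E {b}) p
  have hn0 : n ≠ 0 := by
    rintro rfl
    rw [pow_zero, IntermediateField.finrank_eq_one_iff] at hn
    have : b ∈ adjoin E {b} := mem_adjoin_simple_self E b
    rw [hn] at this
    exact hb' this
  have : p ≤ Module.finrank E (adjoin E {b}) := by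
    rw [hn]
    exact Nat.le_self_pow hn0 p
  rw [eq_of_le_of_finrank_le hbx (hle.trans this)]
  exact mem_adjoin_simple_self E x

theorem rank_adjoin_finset_le (hp : 0 < p) (hE : ∀ x : K, x ^ p ∈ (algebraMap E K).range)
    (S : Finset K) : Module.rank E (adjoin E (S : Set K)) ≤ (p ^ S.card : ℕ) := by
  classical
  induction S using Finset.induction_on with
  | empty => rw [Finset.coe_empty, adjoin_empty, IntermediateField.rank_bot]; simp
  | insert b S hb ih =>
    have h1 : adjoin E ((insert b S : Finset K) : Set K) =
        (adjoin (adjoin E (S : Set K)) {b}).restrictScalars E := by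
      rw [adjoin_adjoin_left]; rw [Finset.coe_insert, Set.union_singleton]
    rw [h1, Finset.card_insert_of_notMem hb]
    have h2 : b ^ p ∈ (algebraMap (adjoin E (S : Set K)) K).range := by
      obtain ⟨a, ha⟩ := hE b
      exact ⟨algebraMap E _ a, by rw [← ha]; rfl⟩
    obtain ⟨h3, h4⟩ := rank_adjoin_simple_le hp h2
    rw [rank_tower_le, pow_succ, Nat.cast_mul]
    refine mul_le_mul' ih ?_
    rw [← Module.finrank_eq_rank]
    exact_mod_cast h4

end rb

theorem exists_rfree {k K : Type*} [Field k] [Field K] [Algebra k K] {p : ℕ} [ExpChar k p]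
    (hp : p.Prime) (F : IntermediateField k K) (hF : ∀ x : K, x ^ p ∈ F) :
    ∃ B : Set K, adjoin F B = ⊤ ∧ RFreeOver F B := by
  obtain ⟨B, hB⟩ := zorn_subset {B : Set K | RFreeOver F B} (by
    intro c hc hchain
    refine ⟨⋃₀ c, ?_, fun s hs => Set.subset_sUnion_of_mem hs⟩
    rintro x ⟨s0, hs0, hx0⟩ hxm
    obtain ⟨T, hT, hxT⟩ := exists_finset_of_mem_adjoin hxm
    have hsub : (insert x (T : Set K)) ⊆ ⋃₀ c := by
      rw [Set.insert_subset_iff]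
      exact ⟨⟨s0, hs0, hx0⟩, fun y hy => (hT hy).1⟩
    obtain ⟨s, hs, hss⟩ := DirectedOn.exists_mem_subset_of_finite_of_subset_sUnion ⟨s0, hs0⟩
      hchain.directedOn (T.finite_toSet.insert x) hsub
    rw [Set.insert_subset_iff] at hss
    refine hc hs x hss.1 (adjoin.mono _ _ _ ?_ hxT)
    exact fun y hy => ⟨hss.2 hy, (hT hy).2⟩)
  refine ⟨B, ?_, hB.prop⟩
  rw [eq_top_iff]
  rintro x -
  by_contra hx
  have hxB : x ∉ B := fun h => hx (subset_adjoin _ _ h)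
  have hfree : RFreeOver F (insert x B) := by
    intro b hb hbm
    by_cases hbx : b = x
    · subst hbx
      exact hx (adjoin.mono _ _ _ (by simp) hbm)
    have hbB : b ∈ B := hb.resolve_left hbx
    have hset : insert x B \ {b} = (B \ {b}) ∪ {x} := by
      ext y; simp only [Set.mem_sdiff, Set.mem_insert_iff, Set.mem_singleton_iff, Set.mem_union]
      constructor
      · tauto
      · rintro (h | rfl)
        · tauto
        · exact ⟨Or.inl rfl, fun h => hbx h.symm⟩
    rw [hset, ← adjoin_adjoin_left] at hbm
    have hpowE : ∀ y : K, y ^ p ∈ (algebraMap (adjoin F (B \ {b})) K).range := fun y =>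
      ⟨algebraMap F _ ⟨y ^ p, hF y⟩, rfl⟩
    have : ExpChar (adjoin F (B \ {b})) p :=
      expChar_of_injective_algebraMap (algebraMap k (adjoin F (B \ {b}))).injective p
    have : IsPurelyInseparable (adjoin F (B \ {b})) K :=
      (isPurelyInseparable_iff_pow_mem _ p).2 fun y => ⟨1, by simpa using hpowE y⟩
    have := exchange (E := adjoin F (B \ {b})) hp (hpowE x) hbm (by
      rintro ⟨y, hy⟩
      refine hB.prop _ hbB ?_
      have hy2 := y.2
      rwa [show (y : K) = b from hy] at hy2)
    have h2 : x ∈ (adjoin (adjoin F (B \ {b})) {b}).restrictScalars F := this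
    rw [adjoin_adjoin_left] at h2
    refine hx (adjoin.mono _ _ _ ?_ h2)
    rw [Set.sdiff_union_self]
    exact Set.union_subset le_rfl (by simpa using hbB)
  exact hxB (hB.le_of_ge hfree (Set.subset_insert x B) (Set.mem_insert x B))

section final

variable {k K : Type*} [Field k] [Field K] [Algebra k K] {p : ℕ} [ExpChar K p]

theorem adjoin_toSubfield_eq (j : ℕ) (N : Subfield K) :
    (adjoin k {x : K | ∃ y ∈ N, y ^ p ^ j = x}).toSubfield =
      P p (algebraMap k K).fieldRange j N := by
  apply le_antisymm
  · rw [IntermediateField.adjoin_toSubfield, Subfield.closure_le]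
    apply Set.union_subset
    · exact fun x hx => le_P j N hx
    · rintro _ ⟨y, hy, rfl⟩
      exact pow_mem_P j N hy
  · rw [P_le_iff]
    refine ⟨?_, fun x hx => subset_adjoin _ _ ⟨x, hx, rfl⟩⟩
    rintro _ ⟨y, rfl⟩
    exact IntermediateField.algebraMap_mem _ y

theorem pClosureOf_toSubfield (L : IntermediateField k K) :
    (pClosureOf p L).toSubfield = P p (algebraMap k K).fieldRange 1 L.toSubfield := by
  rw [← adjoin_toSubfield_eq, pow_one]; rfl

theorem pnClosure_toSubfield (n : ℕ) :
    (pnClosure k K p n).toSubfield = P p (algebraMap k K).fieldRange n ⊤ := by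
  rw [← adjoin_toSubfield_eq]; simp [pnClosure]

theorem pClosure_toSubfield :
    (pClosure k K p).toSubfield = P p (algebraMap k K).fieldRange 1 ⊤ := by
  rw [← adjoin_toSubfield_eq]; simp [pClosure]

theorem mem_expleq {n : ℕ} {x : K} :
    x ∈ expleq k K p n ↔ x ^ p ^ n ∈ (algebraMap k K).fieldRange := by
  constructor
  · intro hx
    have : (expleq k K p n).toSubfield ≤
        (algebraMap k K).fieldRange.comap (iterateFrobenius K p n) := by
      rw [expleq, IntermediateField.adjoin_toSubfield, Subfield.closure_le]
      apply Set.union_subset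
      · rintro _ ⟨y, rfl⟩
        have hy : algebraMap k K y ∈ (algebraMap k K).fieldRange := ⟨y, rfl⟩
        exact pow_mem hy _
      · intro y hy
        exact hy
    exact this hx
  · intro hx
    exact subset_adjoin _ _ hx

theorem rank_le_of_diCard [ExpChar k p] (hp : p.Prime) {d : ℕ} (L : IntermediateField k K)
    (h : diCard k L p ≤ d) :
    Subfield.relrank (P p (algebraMap k K).fieldRange 1 L.toSubfield) L.toSubfield
      ≤ (p ^ d : ℕ) := by
  have : ExpChar L p := expChar_of_injective_algebraMap (algebraMap k L).injective p
  have hpow : ∀ x : L, x ^ p ∈ pClosure k L p := fun x => subset_adjoin _ _ ⟨x, rfl⟩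
  obtain ⟨B0, hB0⟩ := exists_rfree hp (pClosure k L p) hpow
  obtain ⟨B, hB, hBc⟩ : ∃ B : Set L, RBasis k L p B ∧ Cardinal.mk B = diCard k L p :=
    csInf_mem (s := {c : Cardinal | ∃ B : Set L, RBasis k L p B ∧ Cardinal.mk B = c})
      ⟨_, B0, hB0, rfl⟩
  rw [← hBc] at h
  have hfin : B.Finite := Cardinal.lt_aleph0_iff_set_finite.1 (h.trans_lt Cardinal.natCast_lt_aleph0)
  have hcard : hfin.toFinset.card ≤ d := by
    have : Cardinal.mk (hfin.toFinset : Set L) ≤ d := by rwa [hfin.coe_toFinset]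
    rw [Finset.coe_sort_coe, Cardinal.mk_coe_finset] at this
    exact_mod_cast this
  have hr := rank_adjoin_finset_le (E := pClosure k L p) hp.pos
    (fun x => ⟨⟨x ^ p, hpow x⟩, rfl⟩) hfin.toFinset
  rw [hfin.coe_toFinset, hB.1, IntermediateField.rank_top'] at hr
  have hr2 : Subfield.relrank (pClosure k L p).toSubfield ⊤ ≤ (p ^ d : ℕ) := by
    rw [Subfield.relrank_top_right]
    refine hr.trans ?_
    exact_mod_cast Nat.pow_le_pow_right hp.pos hcard
  rw [← Subfield.relrank_map_map _ _ (algebraMap L K)] at hr2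
  have e1 : (⊤ : Subfield L).map (algebraMap L K) = L.toSubfield := by
    ext x
    constructor
    · rintro ⟨y, -, rfl⟩; exact y.2
    · intro hx; exact ⟨⟨x, hx⟩, trivial, rfl⟩
  have e2 : (pClosure k L p).toSubfield.map (algebraMap L K) =
      P p (algebraMap k K).fieldRange 1 L.toSubfield := by
    rw [pClosure_toSubfield]
    apply le_antisymm
    · rw [Subfield.map_le_iff_le_comap, P_le_iff]
      refine ⟨?_, fun x _ => ?_⟩
      · rintro _ ⟨y, rfl⟩
        exact le_P _ _ ⟨y, rfl⟩
      · rw [Subfield.mem_comap, map_pow]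
        exact pow_mem_P 1 L.toSubfield x.2
    · rw [P_le_iff]
      refine ⟨?_, fun x hx => ?_⟩
      · rintro _ ⟨y, rfl⟩
        exact ⟨algebraMap k L y, le_P _ _ ⟨y, rfl⟩, rfl⟩
      · exact ⟨(⟨x, hx⟩ : L) ^ p ^ 1, pow_mem_P 1 ⊤ trivial, rfl⟩
  rwa [e1, e2] at hr2

end final

end QF

/-- If `K/k` is a `q`-finite purely inseparable extension
(`di(K/k)` finite), then `K` is finite over `rp(K/k)` and the sequence `k(K^{p^n})`
stabilizes at `rp(K/k)`. -/
theorem qFinite_finite_over_rp_and_stationary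
    (p : ℕ) [Fact p.Prime] (k K : Type*) [Field k] [Field K] [Algebra k K] [CharP k p]
    [IsPurelyInseparable k K]
    (hq : di k K p < Cardinal.aleph0) :
    FiniteDimensional ↥(rp k K p) K ∧
      ∃ n₀ : ℕ, ∀ n ≥ n₀, pnClosure k K p n = rp k K p := by
  have hp : p.Prime := Fact.out
  have hchk : ExpChar k p := ExpChar.prime hp
  have hchK : ExpChar K p := expChar_of_injective_algebraMap (algebraMap k K).injective p
  obtain ⟨d, hd⟩ := Cardinal.lt_aleph0.1 hq
  have hdn : ∀ n, diCard k (expleq k K p n) p ≤ d := by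
    intro n
    rw [← hd]
    exact le_ciSup (f := fun n => diCard k (expleq k K p n) p)
      Cardinal.bddAbove_of_small n
  obtain ⟨e, he1, he2⟩ := QF.core (p := p) (κ := (algebraMap k K).fieldRange) hp.pos
    (fun n => (expleq k K p n).toSubfield)
    (by
      refine monotone_nat_of_le_succ fun n x hx => ?_
      have hx' := QF.mem_expleq.1 hx
      refine QF.mem_expleq.2 ?_
      rw [pow_succ, pow_mul]
      exact pow_mem hx' _)
    (by
      rintro n _ ⟨y, rfl⟩
      exact IntermediateField.algebraMap_mem _ y)
    (fun n x hx => QF.mem_expleq.1 hx)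
    (fun x => by
      obtain ⟨n, hn⟩ := IsPurelyInseparable.pow_mem k p x
      exact ⟨n, QF.mem_expleq.2 hn⟩)
    (p ^ d) (fun n => QF.rank_le_of_diCard hp _ (hdn n))
  have hrp_le : ∀ n, rp k K p ≤ pnClosure k K p n := by
    intro n
    refine sSup_le fun L hL => ?_
    have hL1 : QF.P p (algebraMap k K).fieldRange 1 L.toSubfield = L.toSubfield := by
      rw [← QF.pClosureOf_toSubfield, show pClosureOf p L = L from hL]
    have hκL : (algebraMap k K).fieldRange ≤ L.toSubfield := by
      rintro _ ⟨y, rfl⟩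
      exact IntermediateField.algebraMap_mem _ y
    have hLn : QF.P p (algebraMap k K).fieldRange n L.toSubfield = L.toSubfield := by
      induction n with
      | zero => exact QF.P_zero hκL
      | succ n ih => rw [← QF.P_comp, ih, hL1]
    change L.toSubfield ≤ (pnClosure k K p n).toSubfield
    rw [QF.pnClosure_toSubfield, ← hLn]
    exact QF.P_mono le_top
  have hle_rp : ∀ n ≥ e, pnClosure k K p n ≤ rp k K p := by
    intro n hn
    have h1 : pnClosure k K p e ≤ rp k K p := by
      refine le_sSup ?_
      change pClosureOf p _ = _
      rw [← IntermediateField.toSubfield_inj, QF.pClosureOf_toSubfield, QF.pnClosure_toSubfield,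
        he1]
    refine le_trans ?_ h1
    change (pnClosure k K p n).toSubfield ≤ (pnClosure k K p e).toSubfield
    rw [QF.pnClosure_toSubfield, QF.pnClosure_toSubfield]
    obtain ⟨m, rfl⟩ := Nat.exists_eq_add_of_le hn
    rw [← QF.P_comp]
    exact QF.P_le (QF.le_P _ _)
  have heq : ∀ n ≥ e, pnClosure k K p n = rp k K p := fun n hn =>
    le_antisymm (hle_rp n hn) (hrp_le n)
  refine ⟨?_, e, heq⟩
  rw [← QF.pnClosure_toSubfield, heq e le_rfl] at he2
  exact Module.rank_lt_aleph0_iff.1 he2
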